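/- For every c ∈ ℝ, φ(c)² ≤ (2/π)·Φ(c)·(1−Φ(c)), with equality when c = 0. Consequently the supremum over c ∈ ℝ of φ(c)/√(Φ(c)·(1−Φ(c))) equals √(2/π) (attained at c = 0), and for every ρ ∈ [−1, 1] and every c ∈ ℝ one has |ρ·φ(c)/√(Φ(c)·(1−Φ(c)))| ≤ √(2/π). -/

import Mathlib

open MeasureTheory

/-- The standard normal density φ(z) = (1/√(2π))·e^{−z²/2}. -/
noncomputable def stdNormalPDF (z : ℝ) : ℝ :=
  (Real.sqrt (2 * Real.pi))⁻¹ * Real.exp (-(z ^ 2) / 2)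

/-- The standard normal cumulative distribution function Φ. -/
noncomputable def stdNormalCDF (x : ℝ) : ℝ :=
  ∫ z in Set.Iic x, stdNormalPDF z

theorem stdNormalPDF_eq_gaussianPDFReal :
    stdNormalPDF = ProbabilityTheory.gaussianPDFReal 0 1 := by
  funext x
  simp [stdNormalPDF, ProbabilityTheory.gaussianPDFReal]

theorem stdNormalPDF_pos (c : ℝ) : 0 < stdNormalPDF c := by
  unfold stdNormalPDF
  positivity

theorem stdNormalPDF_neg (c : ℝ) : stdNormalPDF (-c) = stdNormalPDF c := by
  simp [stdNormalPDF]

theorem stdNormalPDF_zero_sq : stdNormalPDF 0 ^ 2 = 1 / (2 * Real.pi) := by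
  have := Real.pi_pos
  simp only [stdNormalPDF, mul_pow, inv_pow]
  rw [Real.sq_sqrt (by positivity)]
  simp

theorem hasDerivAt_stdNormalPDF (c : ℝ) :
    HasDerivAt stdNormalPDF (-c * stdNormalPDF c) c := by
  have h : HasDerivAt (fun z : ℝ => -(z ^ 2) / 2) (-c) c := by
    refine (((hasDerivAt_id c).pow 2).neg.div_const 2).congr_deriv ?_
    simp only [id]
    push_cast
    ring
  refine (h.exp.const_mul (Real.sqrt (2 * Real.pi))⁻¹).congr_deriv ?_
  simp only [stdNormalPDF]
  ring

theorem continuous_stdNormalPDF : Continuous stdNormalPDF :=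
  continuous_iff_continuousAt.2 fun c => (hasDerivAt_stdNormalPDF c).continuousAt

theorem integrable_stdNormalPDF : Integrable stdNormalPDF := by
  rw [stdNormalPDF_eq_gaussianPDFReal]
  exact ProbabilityTheory.integrable_gaussianPDFReal 0 1

theorem integral_stdNormalPDF : ∫ z, stdNormalPDF z = 1 := by
  rw [stdNormalPDF_eq_gaussianPDFReal]
  exact ProbabilityTheory.integral_gaussianPDFReal_eq_one 0 one_ne_zero

open Filter Topology in
theorem tendsto_stdNormalPDF_atTop : Tendsto stdNormalPDF atTop (𝓝 0) := by
  have h : Tendsto (fun z : ℝ => -(z ^ 2) / 2) atTop atBot := by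
    refine Tendsto.atBot_div_const two_pos (tendsto_neg_atTop_atBot.comp ?_)
    exact tendsto_pow_atTop two_ne_zero
  have h₂ := (Real.tendsto_exp_atBot.comp h).const_mul (Real.sqrt (2 * Real.pi))⁻¹
  rwa [mul_zero] at h₂

theorem hasDerivAt_stdNormalCDF (c : ℝ) : HasDerivAt stdNormalCDF (stdNormalPDF c) c := by
  have h : stdNormalCDF = fun x => (∫ z in (0 : ℝ)..x, stdNormalPDF z) + stdNormalCDF 0 := by
    funext x
    have := intervalIntegral.integral_Iic_sub_Iic (a := 0) (b := x)
      integrable_stdNormalPDF.integrableOn integrable_stdNormalPDF.integrableOn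
    simp only [stdNormalCDF]
    linarith
  rw [h]
  exact (continuous_stdNormalPDF.integral_hasStrictDerivAt 0 c).hasDerivAt.add_const _

theorem stdNormalCDF_neg (c : ℝ) : stdNormalCDF (-c) = 1 - stdNormalCDF c := by
  have h : stdNormalCDF (-c) = ∫ z in Set.Ioi c, stdNormalPDF z := by
    have := integral_comp_neg_Ioi c stdNormalPDF
    simpa only [stdNormalCDF, stdNormalPDF_neg] using this.symm
  have h₂ := intervalIntegral.integral_Iic_add_Ioi (b := c)
    integrable_stdNormalPDF.integrableOn integrable_stdNormalPDF.integrableOn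
  rw [integral_stdNormalPDF] at h₂
  simp only [stdNormalCDF] at *
  linarith

theorem stdNormalCDF_zero : stdNormalCDF 0 = 1 / 2 := by
  have := stdNormalCDF_neg 0
  rw [neg_zero] at this
  linarith

open Filter Topology in
theorem tendsto_stdNormalCDF_atTop : Tendsto stdNormalCDF atTop (𝓝 1) := by
  have h := (aecover_Iic (μ := volume) (tendsto_id (α := ℝ))).integral_tendsto_of_countably_generated
    integrable_stdNormalPDF
  rwa [integral_stdNormalPDF] at h

/-- The gap between the two sides of the bound, normalised by `π / 2`. -/
noncomputable def stdNormalGap (c : ℝ) : ℝ :=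
  stdNormalCDF c * (1 - stdNormalCDF c) - Real.pi / 2 * stdNormalPDF c ^ 2

/-- The factor of the derivative of `stdNormalGap` other than the density. -/
noncomputable def stdNormalGapSlope (c : ℝ) : ℝ :=
  1 - 2 * stdNormalCDF c + Real.pi * (c * stdNormalPDF c)

theorem hasDerivAt_stdNormalGap (c : ℝ) :
    HasDerivAt stdNormalGap (stdNormalPDF c * stdNormalGapSlope c) c := by
  have hΦ := hasDerivAt_stdNormalCDF c
  refine ((hΦ.mul (hΦ.const_sub 1)).sub
    (((hasDerivAt_stdNormalPDF c).pow 2).const_mul (Real.pi / 2))).congr_deriv ?_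
  simp only [stdNormalGapSlope]
  push_cast
  ring

theorem hasDerivAt_stdNormalGapSlope (c : ℝ) :
    HasDerivAt stdNormalGapSlope (stdNormalPDF c * (Real.pi - 2 - Real.pi * c ^ 2)) c := by
  refine ((((hasDerivAt_stdNormalCDF c).const_mul 2).const_sub 1).add
    (((hasDerivAt_id c).mul (hasDerivAt_stdNormalPDF c)).const_mul Real.pi)).congr_deriv ?_
  simp only [id]
  ring

theorem stdNormalGap_zero : stdNormalGap 0 = 0 := by
  have := Real.pi_pos
  rw [stdNormalGap, stdNormalPDF_zero_sq, stdNormalCDF_zero]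
  field_simp
  norm_num

theorem stdNormalGapSlope_zero : stdNormalGapSlope 0 = 0 := by
  simp [stdNormalGapSlope, stdNormalCDF_zero]

open Filter Topology in
theorem tendsto_stdNormalGap_atTop : Tendsto stdNormalGap atTop (𝓝 0) := by
  have hΦ := tendsto_stdNormalCDF_atTop
  have h := (hΦ.mul (hΦ.const_sub 1)).sub
    ((tendsto_stdNormalPDF_atTop.pow 2).const_mul (Real.pi / 2))
  simp only [sub_self, mul_zero, ne_eq, OfNat.ofNat_ne_zero, not_false_eq_true, zero_pow] at h
  exact h

theorem monotoneOn_stdNormalGapSlope {b : ℝ} (hb : Real.pi * b ^ 2 ≤ Real.pi - 2) :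
    MonotoneOn stdNormalGapSlope (Set.Icc 0 b) := by
  refine monotoneOn_of_hasDerivWithinAt_nonneg (convex_Icc 0 b)
    (fun x _ => (hasDerivAt_stdNormalGapSlope x).continuousAt.continuousWithinAt)
    (fun x _ => (hasDerivAt_stdNormalGapSlope x).hasDerivWithinAt) fun x hx => ?_
  rw [interior_Icc] at hx
  have h : x ^ 2 ≤ b ^ 2 := pow_le_pow_left₀ hx.1.le hx.2.le 2
  have := mul_le_mul_of_nonneg_left h Real.pi_pos.le
  exact mul_nonneg (stdNormalPDF_pos x).le (by linarith)

theorem antitoneOn_stdNormalGapSlope {a : ℝ} (ha₀ : 0 ≤ a)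
    (ha : Real.pi - 2 ≤ Real.pi * a ^ 2) :
    AntitoneOn stdNormalGapSlope (Set.Ici a) := by
  refine antitoneOn_of_hasDerivWithinAt_nonpos (convex_Ici a)
    (fun x _ => (hasDerivAt_stdNormalGapSlope x).continuousAt.continuousWithinAt)
    (fun x _ => (hasDerivAt_stdNormalGapSlope x).hasDerivWithinAt) fun x hx => ?_
  rw [interior_Ici] at hx
  have h : a ^ 2 ≤ x ^ 2 := pow_le_pow_left₀ ha₀ (le_of_lt hx) 2
  have := mul_le_mul_of_nonneg_left h Real.pi_pos.le
  exact mul_nonpos_of_nonneg_of_nonpos (stdNormalPDF_pos x).le (by linarith)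

/-- The slope stays nonnegative up to any point where it is nonnegative. -/
theorem stdNormalGapSlope_nonneg_of_le {x c : ℝ} (hx : 0 ≤ x) (hxc : x ≤ c)
    (hc : 0 ≤ stdNormalGapSlope c) : 0 ≤ stdNormalGapSlope x := by
  rcases le_total (Real.pi * x ^ 2) (Real.pi - 2) with h | h
  · rw [← stdNormalGapSlope_zero]
    exact monotoneOn_stdNormalGapSlope h ⟨le_rfl, hx⟩ ⟨hx, le_rfl⟩ hx
  · exact hc.trans (antitoneOn_stdNormalGapSlope hx h Set.self_mem_Ici hxc hxc)

open Filter in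
theorem stdNormalGap_nonneg_of_nonneg {c : ℝ} (hc : 0 ≤ c) : 0 ≤ stdNormalGap c := by
  rcases le_or_gt 0 (stdNormalGapSlope c) with h | h
  · have hmono : MonotoneOn stdNormalGap (Set.Icc 0 c) := by
      refine monotoneOn_of_hasDerivWithinAt_nonneg (convex_Icc 0 c)
        (fun x _ => (hasDerivAt_stdNormalGap x).continuousAt.continuousWithinAt)
        (fun x _ => (hasDerivAt_stdNormalGap x).hasDerivWithinAt) fun x hx => ?_
      rw [interior_Icc] at hx
      exact mul_nonneg (stdNormalPDF_pos x).le
        (stdNormalGapSlope_nonneg_of_le hx.1.le hx.2.le h)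
    rw [← stdNormalGap_zero]
    exact hmono ⟨le_rfl, hc⟩ ⟨hc, le_rfl⟩ hc
  · have hanti : AntitoneOn stdNormalGap (Set.Ici c) := by
      refine antitoneOn_of_hasDerivWithinAt_nonpos (convex_Ici c)
        (fun x _ => (hasDerivAt_stdNormalGap x).continuousAt.continuousWithinAt)
        (fun x _ => (hasDerivAt_stdNormalGap x).hasDerivWithinAt) fun x hx => ?_
      rw [interior_Ici] at hx
      refine mul_nonpos_of_nonneg_of_nonpos (stdNormalPDF_pos x).le ?_
      by_contra! hpos
      exact h.not_ge (stdNormalGapSlope_nonneg_of_le hc (le_of_lt hx) hpos.le)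
    refine le_of_tendsto tendsto_stdNormalGap_atTop ?_
    filter_upwards [eventually_ge_atTop c] with x hx
    exact hanti Set.self_mem_Ici hx hx

theorem stdNormalGap_nonneg (c : ℝ) : 0 ≤ stdNormalGap c := by
  rcases le_total 0 c with hc | hc
  · exact stdNormalGap_nonneg_of_nonneg hc
  · have h := stdNormalGap_nonneg_of_nonneg (neg_nonneg.2 hc)
    simp only [stdNormalGap, stdNormalCDF_neg, stdNormalPDF_neg] at h ⊢
    linarith

theorem stdNormalPDF_sq_le (c : ℝ) :
    stdNormalPDF c ^ 2 ≤ (2 / Real.pi) * (stdNormalCDF c * (1 - stdNormalCDF c)) := by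
  have h := stdNormalGap_nonneg c
  have := Real.pi_pos
  rw [stdNormalGap] at h
  rw [div_mul_eq_mul_div, le_div_iff₀ this]
  linarith

theorem stdNormalPDF_zero_sq_eq :
    stdNormalPDF 0 ^ 2 = (2 / Real.pi) * (stdNormalCDF 0 * (1 - stdNormalCDF 0)) := by
  have := Real.pi_pos
  rw [stdNormalPDF_zero_sq, stdNormalCDF_zero]
  field_simp
  norm_num

theorem stdNormalCDF_mul_one_sub_pos (c : ℝ) :
    0 < stdNormalCDF c * (1 - stdNormalCDF c) :=
  pos_of_mul_pos_right ((pow_pos (stdNormalPDF_pos c) 2).trans_le (stdNormalPDF_sq_le c))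
    (div_pos two_pos Real.pi_pos).le

theorem stdNormalPDF_div_sqrt_le (c : ℝ) :
    stdNormalPDF c / Real.sqrt (stdNormalCDF c * (1 - stdNormalCDF c))
      ≤ Real.sqrt (2 / Real.pi) := by
  rw [div_le_iff₀ (Real.sqrt_pos.2 (stdNormalCDF_mul_one_sub_pos c)),
    ← Real.sqrt_mul (div_pos two_pos Real.pi_pos).le]
  exact Real.le_sqrt_of_sq_le (stdNormalPDF_sq_le c)

theorem stdNormalPDF_zero_div_sqrt :
    stdNormalPDF 0 / Real.sqrt (stdNormalCDF 0 * (1 - stdNormalCDF 0))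
      = Real.sqrt (2 / Real.pi) := by
  rw [div_eq_iff (Real.sqrt_pos.2 (stdNormalCDF_mul_one_sub_pos 0)).ne',
    ← Real.sqrt_mul (div_pos two_pos Real.pi_pos).le, ← stdNormalPDF_zero_sq_eq,
    Real.sqrt_sq (stdNormalPDF_pos 0).le]

theorem stmt_7 :
    (∀ c : ℝ, stdNormalPDF c ^ 2 ≤ (2 / Real.pi) * (stdNormalCDF c * (1 - stdNormalCDF c))) ∧
    (stdNormalPDF 0 ^ 2 = (2 / Real.pi) * (stdNormalCDF 0 * (1 - stdNormalCDF 0))) ∧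
    IsGreatest
      (Set.range fun c : ℝ =>
        stdNormalPDF c / Real.sqrt (stdNormalCDF c * (1 - stdNormalCDF c)))
      (Real.sqrt (2 / Real.pi)) ∧
    (stdNormalPDF 0 / Real.sqrt (stdNormalCDF 0 * (1 - stdNormalCDF 0))
      = Real.sqrt (2 / Real.pi)) ∧
    ∀ ρ ∈ Set.Icc (-1 : ℝ) 1, ∀ c : ℝ,
      |ρ * stdNormalPDF c / Real.sqrt (stdNormalCDF c * (1 - stdNormalCDF c))|
        ≤ Real.sqrt (2 / Real.pi) := by
  refine ⟨stdNormalPDF_sq_le, stdNormalPDF_zero_sq_eq,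
    ⟨⟨0, stdNormalPDF_zero_div_sqrt⟩, ?_⟩, stdNormalPDF_zero_div_sqrt, ?_⟩
  · rintro _ ⟨c, rfl⟩
    exact stdNormalPDF_div_sqrt_le c
  · intro ρ hρ c
    have h := div_nonneg (stdNormalPDF_pos c).le
      (Real.sqrt_nonneg (stdNormalCDF c * (1 - stdNormalCDF c)))
    rw [mul_div_assoc, abs_mul, abs_of_nonneg h]
    exact (mul_le_of_le_one_left h (abs_le.2 hρ)).trans (stdNormalPDF_div_sqrt_le c)
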